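/- Let D ⊆ ℂⁿ be a nonempty open, connected and simply connected set, and let h : ℂⁿ → ℂ be holomorphic on D with h(z) ≠ 0 for every z ∈ D. Then there exists a function g : ℂⁿ → ℂ, holomorphic on D, such that exp(g(z)) = h(z) for every z ∈ D. -/

import Mathlib

/-- On a nonempty open, connected and simply connected set `D ⊆ ℂⁿ`, every
holomorphic nowhere-zero function `h` admits a holomorphic logarithm `g`. -/
theorem holomorphic_log_exists (n : ℕ) (D : Set (Fin n → ℂ))
    (hne : D.Nonempty) (hopen : IsOpen D) (hconn : IsConnected D)
    (hsc : SimplyConnectedSpace D)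
    (h : (Fin n → ℂ) → ℂ) (hh : DifferentiableOn ℂ h D)
    (hz : ∀ z ∈ D, h z ≠ 0) :
    ∃ g : (Fin n → ℂ) → ℂ, DifferentiableOn ℂ g D ∧
      ∀ z ∈ D, Complex.exp (g z) = h z := by
  obtain ⟨g, hgc, hg⟩ := Complex.exists_continuousOn_eqOn_exp_comp (U := D) hsc hopen
    hh.continuousOn (by rintro ⟨z, hzD, h0⟩; exact hz z hzD h0)
  refine ⟨g, fun a ha => ?_, fun z hzD => hg hzD⟩
  have hD : D ∈ nhds a := hopen.mem_nhds ha
  refine DifferentiableAt.differentiableWithinAt ?_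
  refine (HasFDerivAt.of_comp_of_leftInverse
    (f'symm := ContinuousLinearMap.toSpanSingleton ℂ (Complex.exp (g a))⁻¹)
    (hgc.continuousAt hD) (Complex.hasDerivAt_exp (g a)).hasFDerivAt
    (hh.differentiableAt hD).hasFDerivAt (Filter.eventuallyEq_of_mem hD hg) ?_).differentiableAt
  intro w
  simp [mul_assoc, Complex.exp_ne_zero]
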